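/- Let U ⊆ P(d,m) be a color-squarefree monomial order ideal. Then U is color-squarefree shifted if and only if the balanced squeezed complex Δ_bal(U) is color-shifted. -/

import Mathlib

open Finset

noncomputable section

namespace BalSq

variable {d : ℕ} {m : Fin d → ℕ}

/-- The set of variables `x_{i,j}` of `P(d,m)`: the variable `⟨i,j⟩` has color `i`. -/
abbrev Var (d : ℕ) (m : Fin d → ℕ) : Type := Σ i : Fin d, Fin (m i)

/-- Monomials of `P(d,m)`, encoded as exponent vectors. -/
abbrev Mon (d : ℕ) (m : Fin d → ℕ) : Type := Var d m →₀ ℕ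

/-- The vertex set `V = V_1 ∪ ⋯ ∪ V_d`, where `V_i` has `m i + 1` elements;
these are also the variables of `P(d, m + (1,…,1))`. -/
abbrev Vtx (d : ℕ) (m : Fin d → ℕ) : Type := Σ i : Fin d, Fin (m i + 1)

/-- The monomial `x_{i,j}`. -/
def xvar (i : Fin d) (j : Fin (m i)) : Mon d m := Finsupp.single ⟨i, j⟩ 1

/-- Total degree of a monomial. -/
def deg (u : Mon d m) : ℕ := u.sum fun _ n => n

/-- A monomial is color-squarefree if it is divisible by at most one variable of each color. -/
def ColorSquarefree (u : Mon d m) : Prop :=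
  ∀ i : Fin d, (∑ j : Fin (m i), u ⟨i, j⟩) ≤ 1

/-- A color-squarefree monomial order ideal: a finite set of color-squarefree monomials,
closed under divisibility, containing `1` and all the variables. -/
def IsOrderIdeal (U : Finset (Mon d m)) : Prop :=
  (∀ u ∈ U, ColorSquarefree u) ∧
  (∀ u ∈ U, ∀ v : Mon d m, v ≤ u → v ∈ U) ∧
  ((0 : Mon d m) ∈ U) ∧
  (∀ (i : Fin d) (j : Fin (m i)), xvar i j ∈ U)

/-- The strict order `≺` on variables: `x_{i,j} ≺ x_{k,ℓ}` iff `i < k`, or `i = k` and `j < ℓ`. -/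
def vlt (a b : Var d m) : Prop :=
  a.1 < b.1 ∨ (a.1 = b.1 ∧ (a.2 : ℕ) < (b.2 : ℕ))

/-- The vertex of color `i` of the facet `F_d(u)`: the (unique) `j` with `x_{i,j} ∣ u` if it
exists, and the extra vertex `(m i + 1)^{(i)}` otherwise. -/
def vtxOf (u : Mon d m) (i : Fin d) : Fin (m i + 1) :=
  if h : ∃ j : Fin (m i), u ⟨i, j⟩ ≠ 0 then (Classical.choose h).castSucc else Fin.last (m i)

/-- The facet `F_d(u)` associated to a color-squarefree monomial `u`. -/
def Fd (u : Mon d m) : Finset (Vtx d m) :=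
  Finset.univ.image fun i : Fin d => (⟨i, vtxOf u i⟩ : Vtx d m)

/-- The balanced (squeezed) complex `Δ_bal(U)` of a finite set `U` of color-squarefree
monomials: the simplicial complex whose facets are the sets `F_d(u)`, `u ∈ U`. -/
def Dbal (U : Finset (Mon d m)) : Set (Finset (Vtx d m)) :=
  { F | ∃ u ∈ U, F ⊆ Fd u }

/-- `U` is color-squarefree shifted. -/
def Shifted (U : Finset (Mon d m)) : Prop :=
  ∀ (u : Mon d m) (k : Fin d) (l j : Fin (m k)),
    xvar k l + u ∈ U → l < j → xvar k j + u ∈ U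

/-- `U` is color-squarefree shifted across colors. -/
def ShiftedAcross (U : Finset (Mon d m)) : Prop :=
  Shifted U ∧
  ∀ (u : Mon d m) (k : Fin d) (l : Fin (m k)) (i : Fin d) (j : Fin (m i)),
    xvar k l + u ∈ U → vlt ⟨k, l⟩ ⟨i, j⟩ →
    ColorSquarefree (xvar i j + u) → xvar i j + u ∈ U

/-- A balanced complex on `V = V_1 ∪ ⋯ ∪ V_d` is color-shifted if whenever `F ∈ Δ` and
`j^{(i)} ∈ F`, also `(F \ {j^{(i)}}) ∪ {k^{(i)}} ∈ Δ` for all `j ≤ k ≤ m i + 1`. -/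
def ColorShifted (Δ : Set (Finset (Vtx d m))) : Prop :=
  ∀ F ∈ Δ, ∀ (i : Fin d) (j k : Fin (m i + 1)),
    (⟨i, j⟩ : Vtx d m) ∈ F → j ≤ k →
    insert (⟨i, k⟩ : Vtx d m) (F.erase ⟨i, j⟩) ∈ Δ

theorem vtxOf_cast_iff {u : Mon d m} (hu : ColorSquarefree u) (i : Fin d) (j : Fin (m i)) :
    vtxOf u i = j.castSucc ↔ u ⟨i, j⟩ ≠ 0 := by
  unfold vtxOf
  constructor
  · intro h
    split_ifs at h with hh
    · have h2 := Classical.choose_spec hh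
      rw [Fin.castSucc_inj] at h
      rwa [h] at h2
    · exact absurd h.symm (Fin.castSucc_lt_last j).ne
  · intro h
    have hh : ∃ j : Fin (m i), u ⟨i, j⟩ ≠ 0 := ⟨j, h⟩
    rw [dif_pos hh, Fin.castSucc_inj]
    have h2 := Classical.choose_spec hh
    by_contra hne
    have h3 := hu i
    have h4 := Finset.add_le_sum (f := fun j : Fin (m i) => u ⟨i, j⟩) (fun _ _ => Nat.zero_le _)
      (Finset.mem_univ (Classical.choose hh)) (Finset.mem_univ j) hne
    omega

theorem vtxOf_last_iff (u : Mon d m) (i : Fin d) :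
    vtxOf u i = Fin.last (m i) ↔ ∀ j, u ⟨i, j⟩ = 0 := by
  unfold vtxOf
  split_ifs with hh
  · constructor
    · intro h
      exact absurd h (Fin.castSucc_lt_last _).ne
    · intro h
      obtain ⟨j, hj⟩ := hh
      exact absurd (h j) hj
  · push Not at hh
    simpa using hh

theorem vtxOf_congr {u v : Mon d m} (i : Fin d) (h : ∀ j, u ⟨i, j⟩ = v ⟨i, j⟩) :
    vtxOf u i = vtxOf v i := by
  unfold vtxOf
  simp only [h]

theorem csf_le_one {u : Mon d m} (hu : ColorSquarefree u) (a : Var d m) : u a ≤ 1 := by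
  obtain ⟨i, j⟩ := a
  exact (Finset.single_le_sum (f := fun j : Fin (m i) => u ⟨i, j⟩) (fun _ _ => Nat.zero_le _)
    (Finset.mem_univ j)).trans (hu i)

theorem mem_Fd {u : Mon d m} {i : Fin d} {j : Fin (m i + 1)} :
    (⟨i, j⟩ : Vtx d m) ∈ Fd u ↔ vtxOf u i = j := by
  unfold Fd
  simp only [Finset.mem_image, Finset.mem_univ, true_and]
  constructor
  · rintro ⟨a, h⟩
    cases h
    rfl
  · rintro rfl
    exact ⟨i, rfl⟩

theorem xvar_self (i : Fin d) (j : Fin (m i)) : xvar i j ⟨i, j⟩ = 1 := by simp [xvar]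

theorem xvar_ne {k i : Fin d} (l : Fin (m k)) (j : Fin (m i)) (h : i ≠ k) :
    xvar k l ⟨i, j⟩ = 0 := by
  unfold xvar
  rw [Finsupp.single_apply, if_neg]
  intro e
  exact h (congrArg Sigma.fst e).symm

theorem xvar_sum (k i : Fin d) (l : Fin (m k)) :
    (∑ j : Fin (m i), xvar k l ⟨i, j⟩) = if i = k then 1 else 0 := by
  split_ifs with h
  · subst h
    simp [xvar, Finsupp.single_apply]
  · exact Finset.sum_eq_zero fun j _ => xvar_ne l j h

theorem csf_swap {u : Mon d m} {k : Fin d} {l : Fin (m k)} (j : Fin (m k))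
    (h : ColorSquarefree (xvar k l + u)) : ColorSquarefree (xvar k j + u) := by
  intro i
  have := h i
  simp only [Finsupp.add_apply, Finset.sum_add_distrib, xvar_sum] at this ⊢
  exact this

theorem vtxOf_xvar_ne (u : Mon d m) {k i : Fin d} (l : Fin (m k)) (h : i ≠ k) :
    vtxOf (xvar k l + u) i = vtxOf u i :=
  vtxOf_congr i fun j => by simp [xvar_ne l j h]

theorem vtxOf_xvar_self {u : Mon d m} {k : Fin d} {l : Fin (m k)}
    (h : ColorSquarefree (xvar k l + u)) : vtxOf (xvar k l + u) k = l.castSucc := by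
  rw [vtxOf_cast_iff h, Finsupp.add_apply, xvar_self]
  omega

theorem vtxOf_rest {u : Mon d m} {k : Fin d} {l : Fin (m k)}
    (h : ColorSquarefree (xvar k l + u)) : vtxOf u k = Fin.last _ := by
  rw [vtxOf_last_iff]
  intro j
  have := h k
  simp only [Finsupp.add_apply, Finset.sum_add_distrib, xvar_sum, if_true] at this
  have h2 := Finset.single_le_sum (f := fun j : Fin (m k) => u ⟨k, j⟩) (fun _ _ => Nat.zero_le _)
    (Finset.mem_univ j)
  omega

theorem le_of_Fd {u v : Mon d m} (hu : ColorSquarefree u) (hv : ColorSquarefree v)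
    (h : ∀ i, vtxOf v i = vtxOf u i) : u ≤ v := by
  rintro ⟨i, j⟩
  by_cases h0 : u ⟨i, j⟩ = 0
  · omega
  · have h1 := (vtxOf_cast_iff hv i j).1 ((h i).trans ((vtxOf_cast_iff hu i j).2 h0))
    have := csf_le_one hu ⟨i, j⟩
    omega

/-- Lemma `lem:compareIdealAndComplex`.  A color-squarefree monomial order
ideal `U` is color-squarefree shifted iff the balanced squeezed complex `Δ_bal(U)` is
color-shifted. -/
theorem statement_8 (U : Finset (Mon d m)) (hU : IsOrderIdeal U) :
    Shifted U ↔ ColorShifted (Dbal U) := by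
  obtain ⟨hsq, hdiv, -, -⟩ := hU
  constructor
  · rintro hS F ⟨u, hu, hF⟩ i j k hj hjk
    have hvj := mem_Fd.1 (hF hj)
    rcases hjk.eq_or_lt with rfl | hlt
    · rw [Finset.insert_erase hj]
      exact ⟨u, hu, hF⟩
    · obtain ⟨l, rfl⟩ : ∃ l : Fin (m i), j = l.castSucc :=
        ⟨j.castPred (ne_of_lt (lt_of_lt_of_le hlt (Fin.le_last k))), by simp⟩
      have hul := (vtxOf_cast_iff (hsq u hu) i l).1 hvj
      obtain ⟨u', rfl⟩ : ∃ u', u = xvar i l + u' := by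
        refine ⟨u - xvar i l, (add_tsub_cancel_of_le ?_).symm⟩
        unfold xvar
        rw [Finsupp.single_le_iff]
        omega
      have hs := hsq _ hu
      have key : ∀ w, (∀ a, a ≠ i → vtxOf w a = vtxOf u' a) → vtxOf w i = k →
          insert (⟨i, k⟩ : Vtx d m) (F.erase ⟨i, l.castSucc⟩) ⊆ Fd w := by
        intro w hw hwi
        rintro ⟨a, b⟩ hab
        rw [Finset.mem_insert, Finset.mem_erase] at hab
        rw [mem_Fd]
        rcases hab with hab | ⟨hne, hab⟩
        · cases hab
          exact hwi
        · have h1 := mem_Fd.1 (hF hab)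
          by_cases hai : a = i
          · subst hai
            exfalso
            apply hne
            rw [← h1, hvj]
          · rw [hw a hai, ← h1, vtxOf_xvar_ne u' l hai]
      by_cases hk : k = Fin.last _
      · subst hk
        exact ⟨u', hdiv _ hu _ le_add_self, key u' (fun _ _ => rfl) (vtxOf_rest hs)⟩
      · obtain ⟨k', rfl⟩ : ∃ k' : Fin (m i), k = k'.castSucc := ⟨k.castPred hk, by simp⟩
        exact ⟨xvar i k' + u', hS u' i l k' hu (Fin.castSucc_lt_castSucc_iff.1 hlt),
          key _ (fun a ha => vtxOf_xvar_ne u' k' ha) (vtxOf_xvar_self (csf_swap k' hs))⟩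
  · intro hC u k l j hu hlj
    have hs := hsq _ hu
    obtain ⟨v, hv, hsub⟩ := hC (Fd (xvar k l + u)) ⟨_, hu, subset_rfl⟩ k l.castSucc j.castSucc
      (mem_Fd.2 (vtxOf_xvar_self hs)) (Fin.castSucc_lt_castSucc_iff.2 hlj).le
    refine hdiv v hv _ (le_of_Fd (csf_swap j hs) (hsq v hv) fun i => ?_)
    rw [← mem_Fd]
    apply hsub
    rw [Finset.mem_insert, Finset.mem_erase]
    by_cases hik : i = k
    · subst hik
      left
      rw [vtxOf_xvar_self (csf_swap j hs)]
    · right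
      refine ⟨fun e => hik (congrArg Sigma.fst e), ?_⟩
      rw [mem_Fd, vtxOf_xvar_ne u l hik, vtxOf_xvar_ne u j hik]

end BalSq
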